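/- arXiv:2504.05453 — 2 statements merged into one kernel-verified Lean document; each statement's English description precedes it below -/
import Mathlib

section
/- Let m, p be positive integers and let D_ℓ ∈ ℂ^{m×m} for −p ≤ ℓ ≤ p satisfy D_{−ℓ} = D_ℓ† for all ℓ. Suppose the matrix Laurent polynomial P(z) = Σ_{ℓ=−p}^{p} D_ℓ z^ℓ is positive semidefinite (Hermitian with nonnegative eigenvalues) for every z ∈ ℂ with |z| = 1. Then there exist matrices Q₀, Q₁, …, Q_p ∈ ℂ^{m×m} such that for every z with |z| = 1, P(z) = Q(z)† Q(z), where Q(z) = Σ_{ℓ=0}^{p} Q_ℓ z^ℓ. -/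
open Matrix
open scoped ComplexOrder

/-- The Hermitian form `∑ᵢⱼ uᵢ† Xᵢⱼ uⱼ` of a block matrix `X` at a block vector `u`. -/
def blockForm {m n : ℕ} (X : Fin n → Fin n → Matrix (Fin m) (Fin m) ℂ) (u : Fin n → Fin m → ℂ) :
    ℂ :=
  ∑ i, ∑ j, star (u i) ⬝ᵥ (X i j *ᵥ u j)

lemma star_dotProduct_conjTranspose_mulVec {ι κ : Type*} [Fintype ι] [Fintype κ]
    (A : Matrix ι κ ℂ) (x : κ → ℂ) (y : ι → ℂ) :
    star x ⬝ᵥ (Aᴴ *ᵥ y) = star (A *ᵥ x) ⬝ᵥ y := by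
  rw [star_mulVec, dotProduct_mulVec]

/-- A Hermitian matrix has a generalized inverse. -/
lemma Matrix.IsHermitian.exists_generalizedInverse {n : Type*} [Fintype n] [DecidableEq n]
    {C : Matrix n n ℂ} (hC : C.IsHermitian) :
    ∃ G : Matrix n n ℂ, C * G * C = C ∧ (C * G).IsHermitian := by
  have h := hC.spectral_theorem
  set φ := Unitary.conjStarAlgAut ℂ (Matrix n n ℂ) hC.eigenvectorUnitary
  set d : n → ℂ := RCLike.ofReal ∘ hC.eigenvalues with hd
  refine ⟨φ (diagonal fun i => (d i)⁻¹), ?_, ?_⟩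
  · conv_lhs => rw [h]
    conv_rhs => rw [h]
    rw [← map_mul, ← map_mul, diagonal_mul_diagonal, diagonal_mul_diagonal]
    congr 2
    funext i
    exact mul_inv_mul_cancel (d i)
  · rw [h, ← map_mul, diagonal_mul_diagonal, IsHermitian, ← star_eq_conjTranspose, ← map_star,
      star_eq_conjTranspose, diagonal_conjTranspose]
    congr 2
    funext i
    simp [hd]

lemma blockForm_eq_comp {m n : ℕ} (X : Fin n → Fin n → Matrix (Fin m) (Fin m) ℂ)
    (u : Fin n → Fin m → ℂ) :
    blockForm X u = star (fun k : Fin n × Fin m => u k.1 k.2) ⬝ᵥ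
      (Matrix.of (fun (k l : Fin n × Fin m) => X k.1 l.1 k.2 l.2) *ᵥ fun k => u k.1 k.2) := by
  simp only [blockForm, dotProduct, mulVec, Fintype.sum_prod_type, Pi.star_apply, of_apply,
    Finset.mul_sum]
  refine Finset.sum_congr rfl fun i _ => ?_
  rw [Finset.sum_comm]

lemma dotProduct_mulVec_eq_zero_of_blockForm_nonneg {m n : ℕ}
    {X : Fin n → Fin n → Matrix (Fin m) (Fin m) ℂ}
    (hH : ∀ i j, X j i = (X i j)ᴴ) (hX : ∀ u, 0 ≤ blockForm X u) (k j : Fin n)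
    (x w : Fin m → ℂ) (hx : X k k *ᵥ x = 0) : star x ⬝ᵥ (X k j *ᵥ w) = 0 := by
  have hN : (Matrix.of (fun (k l : Fin n × Fin m) => X k.1 l.1 k.2 l.2)).PosSemidef := by
    refine .of_dotProduct_mulVec_nonneg ?_ fun y => ?_
    · ext a b
      simp [hH b.1 a.1]
    · have := hX fun i a => y (i, a)
      rwa [blockForm_eq_comp] at this
  have h0 : blockForm X (Pi.single k x) = 0 := by
    rw [blockForm, Finset.sum_eq_single k, Finset.sum_eq_single k]
    · simp [hx]
    · intro i _ hi; simp [hi]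
    · simp
    · intro i _ hi; simp [hi]
    · simp
  rw [blockForm_eq_comp, hN.dotProduct_mulVec_zero_iff] at h0
  have h1 : X j k *ᵥ x = 0 := by
    ext a
    have := congrFun h0 (j, a)
    simp only [mulVec, dotProduct, Fintype.sum_prod_type, of_apply, Pi.zero_apply] at this ⊢
    rw [Finset.sum_eq_single k] at this
    · simpa using this
    · intro i _ hi; simp [hi]
    · simp
  rw [hH j k, star_dotProduct_conjTranspose_mulVec, h1]
  simp

lemma exists_mul_eq_of_blockForm_nonneg {m n : ℕ}
    {X : Fin n → Fin n → Matrix (Fin m) (Fin m) ℂ}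
    (hH : ∀ i j, X j i = (X i j)ᴴ) (hX : ∀ u, 0 ≤ blockForm X u) (k j : Fin n) :
    ∃ K, X k k * K = X k j := by
  obtain ⟨G, hG, hG'⟩ := IsHermitian.exists_generalizedInverse (hH k k).symm
  have hC : X k k * (1 - X k k * G) = 0 := by
    have h2 := congrArg conjTranspose hG
    rw [conjTranspose_mul, hG'.eq, ← hH k k] at h2
    rw [mul_sub, mul_one, h2, sub_self]
  refine ⟨G * X k j, ?_⟩
  have key : (1 - X k k * G)ᴴ * X k j = 0 := by
    rw [ext_iff_mulVec]
    intro w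
    rw [zero_mulVec, ← mulVec_mulVec, ← dotProduct_star_self_eq_zero,
      star_dotProduct_conjTranspose_mulVec]
    apply dotProduct_mulVec_eq_zero_of_blockForm_nonneg hH hX
    rw [mulVec_mulVec, hC, zero_mulVec]
  rw [conjTranspose_sub, hG'.eq, conjTranspose_one, sub_mul, one_mul, sub_eq_zero] at key
  rw [← mul_assoc, ← key]

lemma Matrix.PosSemidef.exists_eq_conjTranspose_mul_self {n : Type*} [Fintype n] [DecidableEq n]
    {C : Matrix n n ℂ} (hC : C.PosSemidef) : ∃ W : Matrix n n ℂ, C = Wᴴ * W := by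
  open scoped MatrixOrder in
  obtain ⟨W, hW⟩ := CStarAlgebra.nonneg_iff_eq_star_mul_self.mp hC.nonneg
  exact ⟨W, hW⟩

lemma blockForm_add {m n : ℕ} (X Y : Fin n → Fin n → Matrix (Fin m) (Fin m) ℂ)
    (u : Fin n → Fin m → ℂ) :
    blockForm (fun i j => X i j + Y i j) u = blockForm X u + blockForm Y u := by
  simp [blockForm, add_mulVec, dotProduct_add, Finset.sum_add_distrib]

lemma blockForm_conjTranspose_mul {m n : ℕ} (Q : Fin n → Matrix (Fin m) (Fin m) ℂ)
    (u : Fin n → Fin m → ℂ) :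
    blockForm (fun i j => (Q i)ᴴ * Q j) u = star (∑ j, Q j *ᵥ u j) ⬝ᵥ ∑ j, Q j *ᵥ u j := by
  simp only [blockForm, star_sum, sum_dotProduct, dotProduct_sum, ← mulVec_mulVec,
    star_dotProduct_conjTranspose_mulVec]
  exact Finset.sum_comm

lemma blockForm_single {m n : ℕ} (X : Fin n → Fin n → Matrix (Fin m) (Fin m) ℂ) (k : Fin n)
    (x : Fin m → ℂ) : blockForm X (Pi.single k x) = star x ⬝ᵥ (X k k *ᵥ x) := by
  rw [blockForm, Finset.sum_eq_single k, Finset.sum_eq_single k]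
  · simp
  · intro i _ hi; simp [hi]
  · simp
  · intro i _ hi; simp [hi]
  · simp

/-- Block Cholesky step. -/
lemma exists_schurComplement {m n : ℕ}
    {M : Fin (n + 1) → Fin (n + 1) → Matrix (Fin m) (Fin m) ℂ}
    (hH : ∀ i j, M j i = (M i j)ᴴ) (hM : ∀ u, 0 ≤ blockForm M u) :
    ∃ (X : Fin n → Fin n → Matrix (Fin m) (Fin m) ℂ) (Q : Fin (n + 1) → Matrix (Fin m) (Fin m) ℂ),
      (∀ i j, X j i = (X i j)ᴴ) ∧
      (∀ y, blockForm M y = blockForm X (Fin.init y) +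
        star (∑ j, Q j *ᵥ y j) ⬝ᵥ ∑ j, Q j *ᵥ y j) ∧
      ∀ u : Fin n → Fin m → ℂ, ∃ v : Fin m → ℂ,
        blockForm M (Fin.snoc u v : Fin (n + 1) → Fin m → ℂ) = blockForm X u := by
  set l := Fin.last n
  choose K hK using exists_mul_eq_of_blockForm_nonneg hH hM l
  have hC : (M l l).PosSemidef :=
    .of_dotProduct_mulVec_nonneg (hH l l).symm fun x => by
      simpa [blockForm_single] using hM (Pi.single l x)
  obtain ⟨W, hW⟩ := hC.exists_eq_conjTranspose_mul_self
  set K' : Fin (n + 1) → Matrix (Fin m) (Fin m) ℂ := Fin.snoc (fun j => K j.castSucc) 1 with hK'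
  have hKl : K' l = 1 := by simp [hK', l]
  have hMK : ∀ j, M l l * K' j = M l j := by
    refine Fin.lastCases (by simp [hK', l]) fun j => ?_
    simpa [hK'] using hK j.castSucc
  have hMK' : ∀ j, (K' j)ᴴ * M l l = M j l := by
    intro j
    rw [hH l j, ← hMK j, conjTranspose_mul, ← hH l l]
  set R : Fin (n + 1) → Fin (n + 1) → Matrix (Fin m) (Fin m) ℂ :=
    fun i j => M i j - (K' i)ᴴ * M l l * K' j with hR
  have hRl : ∀ i, R i l = 0 := fun i => by simp only [hR, hKl, mul_one, hMK', sub_self]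
  have hlR : ∀ j, R l j = 0 := fun j => by
    simp only [hR, hKl, conjTranspose_one, one_mul, hMK, sub_self]
  have hMR : M = fun i j => R i j + (W * K' i)ᴴ * (W * K' j) := by
    funext i j
    simp only [hR]
    rw [conjTranspose_mul, mul_assoc (K' i)ᴴ Wᴴ, ← mul_assoc Wᴴ, ← hW, mul_assoc,
      sub_add_cancel]
  have hform : ∀ y, blockForm M y = blockForm (fun i j : Fin n => R i.castSucc j.castSucc)
      (Fin.init y) + star (∑ j, (W * K' j) *ᵥ y j) ⬝ᵥ ∑ j, (W * K' j) *ᵥ y j := by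
    intro y
    conv_lhs => rw [hMR]
    rw [blockForm_add R, blockForm_conjTranspose_mul fun j => W * K' j]
    congr 1
    simp [blockForm, Fin.sum_univ_castSucc, Fin.init,
      show ∀ i, R i (Fin.last n) = 0 from hRl, show ∀ j, R (Fin.last n) j = 0 from hlR]
  refine ⟨_, _, ?_, hform, fun u => ⟨-∑ j : Fin n, K' j.castSucc *ᵥ u j, ?_⟩⟩
  · intro i j
    simp only [hR, conjTranspose_sub, conjTranspose_mul, conjTranspose_conjTranspose, ← hH,
      mul_assoc]
  · have h0 : ∑ j, (W * K' j) *ᵥ (Fin.snoc u (-∑ j : Fin n, K' j.castSucc *ᵥ u j) :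
        Fin (n + 1) → Fin m → ℂ) j = 0 := by
      rw [Fin.sum_univ_castSucc]
      simp only [Fin.snoc_castSucc, Fin.snoc_last]
      rw [show K' (Fin.last n) = 1 from hKl, mulVec_neg, mulVec_sum, mul_one]
      simp [mulVec_mulVec]
    rw [hform, h0]
    simp

/-- Extend a block matrix by a first row and column with Toeplitz entries. -/
def toeplitzBorder {m n : ℕ} (D : ℤ → Matrix (Fin m) (Fin m) ℂ)
    (X : Fin n → Fin n → Matrix (Fin m) (Fin m) ℂ) :
    Fin (n + 1) → Fin (n + 1) → Matrix (Fin m) (Fin m) ℂ :=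
  Fin.cons (fun j => D j) fun i => Fin.cons (D (-(i + 1))) (X i)

lemma toeplitzBorder_conjTranspose {m n : ℕ} {D : ℤ → Matrix (Fin m) (Fin m) ℂ}
    (hD : ∀ ℓ, D (-ℓ) = (D ℓ)ᴴ) {X : Fin n → Fin n → Matrix (Fin m) (Fin m) ℂ}
    (hX : ∀ i j, X j i = (X i j)ᴴ) (i j : Fin (n + 1)) :
    toeplitzBorder D X j i = (toeplitzBorder D X i j)ᴴ := by
  refine Fin.cases (Fin.cases ?_ (fun j => ?_) j) (fun i => Fin.cases ?_ (fun j => ?_) j) i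
  · simpa [toeplitzBorder] using hD 0
  · simpa [toeplitzBorder] using hD (j + 1)
  · simp [toeplitzBorder, ← hD, -neg_add_rev]
  · simpa [toeplitzBorder] using hX i j

lemma blockForm_toeplitzBorder {m n : ℕ} (D : ℤ → Matrix (Fin m) (Fin m) ℂ)
    (X : Fin n → Fin n → Matrix (Fin m) (Fin m) ℂ) (y : Fin (n + 1) → Fin m → ℂ) :
    blockForm (toeplitzBorder D X) y = star (y 0) ⬝ᵥ (D 0 *ᵥ y 0) +
      ∑ j : Fin n, (star (y 0) ⬝ᵥ (D (j + 1) *ᵥ y j.succ) +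
        star (y j.succ) ⬝ᵥ (D (-(j + 1)) *ᵥ y 0)) + blockForm X (Fin.tail y) := by
  simp only [blockForm, Fin.sum_univ_succ, toeplitzBorder, Fin.cons_zero, Fin.cons_succ,
    Finset.sum_add_distrib, Fin.tail, Fin.val_zero, Fin.val_succ]
  push_cast
  ring

/-- The block Toeplitz matrix with symbol `∑ D_ℓ z^ℓ`. -/
def toeplitzBlock {m : ℕ} (D : ℤ → Matrix (Fin m) (Fin m) ℂ) (n : ℕ) :
    Fin n → Fin n → Matrix (Fin m) (Fin m) ℂ :=
  fun i j => D (j - i)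

lemma toeplitzBlock_succ {m : ℕ} (D : ℤ → Matrix (Fin m) (Fin m) ℂ) (n : ℕ) :
    toeplitzBlock D (n + 1) = toeplitzBorder D (toeplitzBlock D n) := by
  funext i j
  refine Fin.cases (Fin.cases ?_ (fun j => ?_) j) (fun i => Fin.cases ?_ (fun j => ?_) j) i <;>
  simp [toeplitzBlock, toeplitzBorder]

lemma exists_toeplitzBlock_eq_blockForm_toeplitzBorder {m p : ℕ}
    {D : ℤ → Matrix (Fin m) (Fin m) ℂ} (hD : ∀ ℓ : ℤ, (p : ℤ) < |ℓ| → D ℓ = 0)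
    {X : Fin p → Fin p → Matrix (Fin m) (Fin m) ℂ}
    (hX : ∀ u : Fin p → Fin m → ℂ, ∃ (n : ℕ) (w : ℕ → Fin m → ℂ), (∀ i : Fin p, w i = u i) ∧
      blockForm X u = blockForm (toeplitzBlock D (p + n)) fun i => w i)
    (y : Fin (p + 1) → Fin m → ℂ) :
    ∃ (n : ℕ) (w : ℕ → Fin m → ℂ), (∀ i : Fin (p + 1), w i = y i) ∧
      blockForm (toeplitzBorder D X) y = blockForm (toeplitzBlock D (p + n)) fun i => w i := by
  obtain ⟨n, w, hw, h⟩ := hX (Fin.tail y)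
  refine ⟨n + 1, fun k => Nat.casesOn k (y 0) w, Fin.cases rfl fun i => hw i, ?_⟩
  rw [show p + (n + 1) = p + n + 1 from rfl, toeplitzBlock_succ, blockForm_toeplitzBorder,
    blockForm_toeplitzBorder, h]
  congr 2
  rw [Fin.sum_univ_add]
  have hfar : ∀ i : Fin n, D ((p : ℤ) + i + 1) = 0 := fun i => hD _ (by rw [abs_of_pos] <;> omega)
  have hfar' : ∀ i : Fin n, D (-((p : ℤ) + i + 1)) = 0 :=
    fun i => hD _ (by rw [abs_neg, abs_of_pos] <;> omega)
  have hw' : ∀ i : Fin p, w i = y i.succ := hw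
  simp [hfar, hfar', hw', -neg_add_rev]

lemma IsPrimitiveRoot.sum_pow_zpow_eq {L : ℕ} {ω : ℂ} (hω : IsPrimitiveRoot ω L) (s : ℤ)
    (hs : |s| < L) : ∑ k ∈ Finset.range L, (ω ^ k) ^ s = if s = 0 then (L : ℂ) else 0 := by
  split_ifs with h
  · simp [h]
  · have h1 : ω ^ s ≠ 1 := fun h2 =>
      h (Int.eq_zero_of_abs_lt_dvd ((hω.zpow_eq_one_iff_dvd s).mp h2) hs)
    have h3 : ∀ k : ℕ, (ω ^ k) ^ s = (ω ^ s) ^ k := fun k => by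
      rw [← zpow_natCast, ← zpow_natCast, zpow_comm]
    simp only [h3]
    rw [geom_sum_eq h1, ← h3, hω.pow_eq_one]
    simp

/-- A block Toeplitz matrix whose symbol is nonnegative on the circle is nonnegative. -/
lemma blockForm_toeplitzBlock_nonneg {m p : ℕ} {D : ℤ → Matrix (Fin m) (Fin m) ℂ}
    (hD : ∀ ℓ : ℤ, (p : ℤ) < |ℓ| → D ℓ = 0)
    (hpos : ∀ z : ℂ, ‖z‖ = 1 →
      (∑ ℓ ∈ Finset.Icc (-(p : ℤ)) (p : ℤ), z ^ ℓ • D ℓ).PosSemidef)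
    (N : ℕ) (w : Fin N → Fin m → ℂ) : 0 ≤ blockForm (toeplitzBlock D N) w := by
  set L : ℕ := N + p + 1 with hL
  have hω := Complex.isPrimitiveRoot_exp L (by omega)
  set ω := Complex.exp (2 * Real.pi * Complex.I / L)
  have hnorm : ‖ω‖ = 1 := hω.norm'_eq_one (by omega)
  have hexp : ∀ z : ℂ, ‖z‖ = 1 →
      star (∑ i : Fin N, (z ^ (-(i : ℤ))) • w i) ⬝ᵥ ((∑ ℓ ∈ Finset.Icc (-(p : ℤ)) (p : ℤ), z ^ ℓ • D ℓ) *ᵥ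
        ∑ i : Fin N, (z ^ (-(i : ℤ))) • w i) =
      ∑ i : Fin N, ∑ j : Fin N, ∑ ℓ ∈ Finset.Icc (-(p : ℤ)) (p : ℤ),
        z ^ ((i : ℤ) + ℓ - j) * (star (w i) ⬝ᵥ (D ℓ *ᵥ w j)) := by
    intro z hz
    have hz0 : z ≠ 0 := by rintro rfl; simp at hz
    have hconj : star z = z⁻¹ := (Complex.inv_eq_conj hz).symm
    rw [star_sum, sum_dotProduct]
    refine Finset.sum_congr rfl fun i _ => ?_
    rw [mulVec_sum, dotProduct_sum]
    refine Finset.sum_congr rfl fun j _ => ?_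
    rw [sum_mulVec, dotProduct_sum]
    refine Finset.sum_congr rfl fun ℓ _ => ?_
    rw [star_smul, smul_dotProduct, smul_mulVec, mulVec_smul, dotProduct_smul, dotProduct_smul,
      star_zpow₀, hconj, smul_eq_mul, smul_eq_mul, smul_eq_mul, sub_eq_add_neg, zpow_add₀ hz0,
      zpow_add₀ hz0, _root_.inv_zpow', neg_neg]
    ring
  have hsum : ∑ k ∈ Finset.range L, ∑ i : Fin N, ∑ j : Fin N, ∑ ℓ ∈ Finset.Icc (-(p : ℤ)) (p : ℤ),
        (ω ^ k) ^ ((i : ℤ) + ℓ - j) * (star (w i) ⬝ᵥ (D ℓ *ᵥ w j)) =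
      L * blockForm (toeplitzBlock D N) w := by
    rw [Finset.sum_comm, blockForm, Finset.mul_sum]
    refine Finset.sum_congr rfl fun i _ => ?_
    rw [Finset.sum_comm, Finset.mul_sum]
    refine Finset.sum_congr rfl fun j _ => ?_
    rw [Finset.sum_comm, Finset.sum_eq_single ((j : ℤ) - i)]
    · rw [← Finset.sum_mul, hω.sum_pow_zpow_eq _ (by simp; omega)]
      simp [toeplitzBlock]
    · intro ℓ hℓ hne
      rw [Finset.mem_Icc] at hℓ
      rw [← Finset.sum_mul, hω.sum_pow_zpow_eq _ (by rw [abs_lt]; omega), if_neg (by omega),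
        zero_mul]
    · intro hmem
      rw [hD ((j : ℤ) - i)]
      · simp
      · rw [Finset.mem_Icc] at hmem
        rw [lt_abs]
        omega
  have hnonneg : 0 ≤ (L : ℂ) * blockForm (toeplitzBlock D N) w := by
    rw [← hsum]
    refine Finset.sum_nonneg fun k _ => ?_
    have hk : ‖ω ^ k‖ = 1 := by rw [norm_pow, hnorm, one_pow]
    rw [← hexp _ hk]
    exact (hpos _ hk).dotProduct_mulVec_nonneg _
  have hLpos : (0 : ℂ) < L := by exact_mod_cast Nat.succ_pos _
  have := mul_nonneg (inv_nonneg.mpr hLpos.le) hnonneg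
  rwa [inv_mul_cancel_left₀ hLpos.ne'] at this

lemma sum_Icc_neg_eq {M : Type*} [AddCommMonoid M] (g : ℤ → M) (p : ℕ) :
    ∑ ℓ ∈ Finset.Icc (-(p : ℤ)) p, g ℓ = g 0 + ∑ j : Fin p, (g (j + 1) + g (-(j + 1))) := by
  induction p with
  | zero => simp
  | succ p ih =>
    have h : Finset.Icc (-((p + 1 : ℕ) : ℤ)) ((p + 1 : ℕ) : ℤ) =
        insert ((p : ℤ) + 1) (insert (-((p : ℤ) + 1)) (Finset.Icc (-(p : ℤ)) p)) := by
      ext x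
      simp only [Finset.mem_insert, Finset.mem_Icc]
      push_cast
      omega
    rw [h, Finset.sum_insert (by simp; omega), Finset.sum_insert (by simp), ih,
      Fin.sum_univ_castSucc]
    simp only [Fin.val_castSucc, Fin.val_last]
    abel

lemma blockForm_toeplitzBorder_zpow {m p : ℕ} (D : ℤ → Matrix (Fin m) (Fin m) ℂ)
    (X : Fin p → Fin p → Matrix (Fin m) (Fin m) ℂ) {z : ℂ} (hz : ‖z‖ = 1) (v : Fin m → ℂ) :
    blockForm (toeplitzBorder D X) (fun j => z ^ (j : ℕ) • v) =
      star v ⬝ᵥ ((∑ ℓ ∈ Finset.Icc (-(p : ℤ)) (p : ℤ), z ^ ℓ • D ℓ) *ᵥ v) +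
        blockForm X fun j => z ^ (j : ℕ) • v := by
  have hconj : star z = z⁻¹ := (Complex.inv_eq_conj hz).symm
  have hz0 : z ≠ 0 := by rintro rfl; simp at hz
  rw [blockForm_toeplitzBorder]
  congr 1
  · have hcast : ∀ j : ℕ, z ^ ((j : ℤ) + 1) = z ^ (j + 1) := fun j => by exact_mod_cast rfl
    rw [sum_mulVec, dotProduct_sum, sum_Icc_neg_eq]
    simp only [smul_mulVec, dotProduct_smul, smul_dotProduct, star_smul, mulVec_smul, star_pow,
      hconj, Fin.val_succ, Fin.val_zero, pow_zero, zpow_zero, one_smul, _root_.zpow_neg, inv_pow,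
      hcast]
  · simp only [blockForm, Fin.tail, star_smul, mulVec_smul, smul_dotProduct, dotProduct_smul,
      Fin.val_succ, star_pow, hconj, smul_eq_mul, inv_pow]
    refine Finset.sum_congr rfl fun i _ => Finset.sum_congr rfl fun j _ => ?_
    field_simp
    ring

lemma blockForm_toeplitzBlock_snoc_zero {m : ℕ} (D : ℤ → Matrix (Fin m) (Fin m) ℂ) {n : ℕ}
    (u : Fin n → Fin m → ℂ) :
    blockForm (toeplitzBlock D (n + 1)) (Fin.snoc u 0 : Fin (n + 1) → Fin m → ℂ) =
      blockForm (toeplitzBlock D n) u := by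
  simp [blockForm, Fin.sum_univ_castSucc, toeplitzBlock]

/-- The iterated Schur complements of a nonnegative banded block Toeplitz matrix form a
decreasing sequence of nonnegative block matrices. -/
lemma exists_schurComplement_sequence {m p : ℕ} {D : ℤ → Matrix (Fin m) (Fin m) ℂ}
    (hD : ∀ ℓ : ℤ, (p : ℤ) < |ℓ| → D ℓ = 0) (hherm : ∀ ℓ : ℤ, D (-ℓ) = (D ℓ)ᴴ)
    (hpos : ∀ z : ℂ, ‖z‖ = 1 →
      (∑ ℓ ∈ Finset.Icc (-(p : ℤ)) (p : ℤ), z ^ ℓ • D ℓ).PosSemidef) :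
    ∃ (X : ℕ → Fin p → Fin p → Matrix (Fin m) (Fin m) ℂ)
      (Q : ℕ → Fin (p + 1) → Matrix (Fin m) (Fin m) ℂ),
      (∀ n u, 0 ≤ blockForm (X n) u) ∧
      (∀ u, Antitone fun n => blockForm (X n) u) ∧
      ∀ n y, blockForm (toeplitzBorder D (X n)) y = blockForm (X (n + 1)) (Fin.init y) +
        star (∑ j, Q n j *ᵥ y j) ⬝ᵥ ∑ j, Q n j *ᵥ y j := by
  have hT := blockForm_toeplitzBlock_nonneg hD hpos
  let S := {X : Fin p → Fin p → Matrix (Fin m) (Fin m) ℂ // (∀ i j, X j i = (X i j)ᴴ) ∧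
    ∀ u : Fin p → Fin m → ℂ, ∃ (n : ℕ) (w : ℕ → Fin m → ℂ), (∀ i : Fin p, w i = u i) ∧
      blockForm X u = blockForm (toeplitzBlock D (p + n)) fun i => w i}
  have step : ∀ X : S, ∃ (X' : S) (Q : Fin (p + 1) → Matrix (Fin m) (Fin m) ℂ),
      (∀ y, blockForm (toeplitzBorder D X.1) y = blockForm X'.1 (Fin.init y) +
        star (∑ j, Q j *ᵥ y j) ⬝ᵥ ∑ j, Q j *ᵥ y j) ∧
      ∀ u : Fin p → Fin m → ℂ, ∃ v : Fin m → ℂ,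
        blockForm (toeplitzBorder D X.1) (Fin.snoc u v : Fin (p + 1) → Fin m → ℂ) =
          blockForm X'.1 u := by
    rintro ⟨X, hXH, hX⟩
    have hB := exists_toeplitzBlock_eq_blockForm_toeplitzBorder hD hX
    obtain ⟨X', Q, hX'H, hform, hmin⟩ := exists_schurComplement
      (toeplitzBorder_conjTranspose hherm hXH) fun y => by
        obtain ⟨n, w, -, h⟩ := hB y
        exact h ▸ hT _ _
    refine ⟨⟨X', hX'H, fun u => ?_⟩, Q, hform, hmin⟩
    obtain ⟨v, hv⟩ := hmin u
    obtain ⟨n, w, hw, h⟩ := hB (Fin.snoc u v : Fin (p + 1) → Fin m → ℂ)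
    exact ⟨n, w, fun i => by simpa using hw i.castSucc, hv ▸ h⟩
  choose F Q hform hmin using step
  let X₀ : S := ⟨toeplitzBlock D p, fun i j => by simp [toeplitzBlock, ← hherm],
    fun u => ⟨0, fun k => if h : k < p then u ⟨k, h⟩ else 0, by simp, by simp⟩⟩
  let X : ℕ → S := fun n => F^[n] X₀
  have hXs : ∀ n, X (n + 1) = F (X n) := fun n => Function.iterate_succ_apply' F n X₀
  have hle : ∀ (Y : S) (u : Fin p → Fin m → ℂ) (v : Fin m → ℂ), blockForm (F Y).1 u ≤
      blockForm (toeplitzBorder D Y.1) (Fin.snoc u v : Fin (p + 1) → Fin m → ℂ) := by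
    intro Y u v
    rw [hform, Fin.init_snoc]
    exact le_add_of_nonneg_right (dotProduct_star_self_nonneg _)
  have hanti : ∀ n u, blockForm (X (n + 1)).1 u ≤ blockForm (X n).1 u := by
    intro n
    induction n with
    | zero =>
      intro u
      refine (hle X₀ u 0).trans_eq ?_
      rw [← toeplitzBlock_succ]
      exact blockForm_toeplitzBlock_snoc_zero D u
    | succ n ih =>
      intro u
      obtain ⟨v, hv⟩ := hmin (X n) u
      rw [hXs (n + 1)]
      conv_rhs => rw [hXs n, ← hv]
      refine (hle (X (n + 1)) u v).trans ?_
      rw [blockForm_toeplitzBorder, blockForm_toeplitzBorder]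
      gcongr
      exact ih _
  refine ⟨fun n => (X n).1, fun n => Q (X n), fun n u => ?_, fun u => antitone_nat_of_succ_le
    fun n => hanti n u, fun n y => ?_⟩
  · obtain ⟨k, w, -, h⟩ := (X n).2.2 u
    exact h ▸ hT _ _
  · simp only [hXs]
    exact hform _ _

lemma Complex.exists_tendsto_of_antitone {f : ℕ → ℂ} (hf : Antitone f) (h0 : ∀ n, 0 ≤ f n) :
    ∃ a, Filter.Tendsto f Filter.atTop (nhds a) := by
  have hre : Antitone fun n => (f n).re := fun i j hij => (Complex.le_def.mp (hf hij)).1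
  have hlim := tendsto_atTop_ciInf hre ⟨0, by rintro _ ⟨n, rfl⟩; exact (Complex.le_def.mp (h0 n)).1⟩
  refine ⟨_, ((Complex.continuous_ofReal.tendsto _).comp hlim).congr fun n => ?_⟩
  exact Complex.ext rfl (Complex.le_def.mp (h0 n)).2

lemma norm_sq_le_star_dotProduct_self {m : ℕ} (x : Fin m → ℂ) (a : Fin m) :
    ‖x a‖ ^ 2 ≤ (star x ⬝ᵥ x).re := by
  have h : (star x ⬝ᵥ x).re = ∑ b, ‖x b‖ ^ 2 := by
    simp [dotProduct, Complex.re_sum, ← Complex.normSq_eq_norm_sq, Complex.normSq_apply]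
  rw [h]
  exact Finset.single_le_sum (f := fun b => ‖x b‖ ^ 2) (fun _ _ => by positivity)
    (Finset.mem_univ a)

/-- The matrix Fejér–Riesz theorem for coefficients vanishing beyond degree `p`. -/
lemma matrix_fejer_riesz_of_banded {m p : ℕ} {D : ℤ → Matrix (Fin m) (Fin m) ℂ}
    (hD : ∀ ℓ : ℤ, (p : ℤ) < |ℓ| → D ℓ = 0) (hherm : ∀ ℓ : ℤ, D (-ℓ) = (D ℓ)ᴴ)
    (hpos : ∀ z : ℂ, ‖z‖ = 1 →
      (∑ ℓ ∈ Finset.Icc (-(p : ℤ)) (p : ℤ), z ^ ℓ • D ℓ).PosSemidef) :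
    ∃ Q : Fin (p + 1) → Matrix (Fin m) (Fin m) ℂ, ∀ z : ℂ, ‖z‖ = 1 →
      (∑ ℓ ∈ Finset.Icc (-(p : ℤ)) (p : ℤ), z ^ ℓ • D ℓ) =
        (∑ j : Fin (p + 1), z ^ (j : ℕ) • Q j)ᴴ * ∑ j : Fin (p + 1), z ^ (j : ℕ) • Q j := by
  obtain ⟨X, Q, hX0, hanti, hform⟩ := exists_schurComplement_sequence hD hherm hpos
  set c : Fin (p + 1) → Fin m → ℝ := fun j b =>
    (blockForm (toeplitzBorder D (X 0)) (Pi.single j (Pi.single b 1))).re with hc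
  have hbound : ∀ n j a b, ‖Q n j a b‖ ^ 2 ≤ c j b := by
    intro n j a b
    have h1 := hform n (Pi.single j (Pi.single b 1))
    have h2 : ∑ k, Q n k *ᵥ (Pi.single j (Pi.single b 1) : Fin (p + 1) → Fin m → ℂ) k =
        (Q n j).col b := by
      rw [Finset.sum_eq_single j]
      · simp
      · intro i _ hi; simp [hi]
      · simp
    rw [h2] at h1
    have h3 : star ((Q n j).col b) ⬝ᵥ (Q n j).col b ≤
        blockForm (toeplitzBorder D (X 0)) (Pi.single j (Pi.single b 1)) := by
      refine (le_add_of_nonneg_left (hX0 (n + 1) _)).trans (h1.symm.le.trans ?_)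
      rw [blockForm_toeplitzBorder, blockForm_toeplitzBorder]
      gcongr
      exact hanti _ (Nat.zero_le n)
    exact (norm_sq_le_star_dotProduct_self ((Q n j).col b) a).trans (Complex.le_def.mp h3).1
  set K : Set (Fin (p + 1) → Fin m → Fin m → ℂ) :=
    Set.pi Set.univ fun j => Set.pi Set.univ fun a => Set.pi Set.univ fun b =>
      Metric.closedBall 0 (Real.sqrt (c j b)) with hK
  have hKc : IsCompact K := isCompact_univ_pi fun j => isCompact_univ_pi fun a =>
    isCompact_univ_pi fun b => isCompact_closedBall _ _
  obtain ⟨R, -, φ, hφ, hR⟩ := hKc.tendsto_subseq (x := fun n j a b => Q n j a b) fun n => by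
    simp only [hK, Set.mem_pi, Set.mem_univ, true_implies, mem_closedBall_zero_iff]
    exact fun j a b => Real.le_sqrt_of_sq_le (hbound n j a b)
  refine ⟨fun j => Matrix.of (R j), fun z hz => ?_⟩
  set P := ∑ ℓ ∈ Finset.Icc (-(p : ℤ)) (p : ℤ), z ^ ℓ • D ℓ
  have hv : ∀ v : Fin m → ℂ, star v ⬝ᵥ (P *ᵥ v) =
      star v ⬝ᵥ (((∑ j : Fin (p + 1), z ^ (j : ℕ) • Matrix.of (R j))ᴴ *
        ∑ j : Fin (p + 1), z ^ (j : ℕ) • Matrix.of (R j)) *ᵥ v) := by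
    intro v
    set g : (Fin (p + 1) → Matrix (Fin m) (Fin m) ℂ) → ℂ := fun Y =>
      star v ⬝ᵥ (((∑ j : Fin (p + 1), z ^ (j : ℕ) • Y j)ᴴ * ∑ j : Fin (p + 1), z ^ (j : ℕ) • Y j) *ᵥ v) with hg
    have hgc : Continuous g := by
      rw [hg]
      fun_prop
    have h1 : ∀ n, g (Q n) = star v ⬝ᵥ (P *ᵥ v) +
        (blockForm (X n) (fun j => z ^ (j : ℕ) • v) -
          blockForm (X (n + 1)) fun j => z ^ (j : ℕ) • v) := by
      intro n
      have h2 := hform n fun j => z ^ (j : ℕ) • v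
      rw [blockForm_toeplitzBorder_zpow D _ hz] at h2
      have h3 : g (Q n) = star (∑ j, Q n j *ᵥ (z ^ (j : ℕ) • v)) ⬝ᵥ
          ∑ j, Q n j *ᵥ (z ^ (j : ℕ) • v) := by
        simp only [hg]
        rw [← mulVec_mulVec, star_dotProduct_conjTranspose_mulVec, sum_mulVec]
        simp only [smul_mulVec, mulVec_smul]
      have h4 : (Fin.init fun j : Fin (p + 1) => z ^ (j : ℕ) • v) =
          fun j : Fin p => z ^ (j : ℕ) • v := by
        funext j
        simp [Fin.init]
      rw [h3, ← add_sub_assoc, h2, h4]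
      ring
    obtain ⟨a, ha⟩ := Complex.exists_tendsto_of_antitone (hanti fun j => z ^ (j : ℕ) • v)
      fun n => hX0 n _
    have hlim : Filter.Tendsto (fun n => g (Q n)) Filter.atTop (nhds (star v ⬝ᵥ (P *ᵥ v))) := by
      simp only [h1]
      simpa using (ha.sub (ha.comp (Filter.tendsto_add_atTop_nat 1))).const_add
        (star v ⬝ᵥ (P *ᵥ v))
    exact tendsto_nhds_unique (hlim.comp hφ.tendsto_atTop) ((hgc.tendsto R).comp hR)
  have hzero : (P - (∑ j : Fin (p + 1), z ^ (j : ℕ) • Matrix.of (R j))ᴴ *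
      ∑ j : Fin (p + 1), z ^ (j : ℕ) • Matrix.of (R j)).PosSemidef := by
    refine .of_dotProduct_mulVec_nonneg
      ((hpos z hz).isHermitian.sub (isHermitian_conjTranspose_mul_self _)) fun v => ?_
    rw [sub_mulVec, dotProduct_sub, hv, sub_self]
  refine sub_eq_zero.mp (ext_iff_mulVec.mpr ?_)
  intro v
  rw [zero_mulVec, ← hzero.dotProduct_mulVec_zero_iff, sub_mulVec, dotProduct_sub, hv, sub_self]

/-- matrix-valued Fejér–Riesz theorem in one variable: if the matrix Laurent
polynomial `P(z) = ∑_{ℓ=-p}^{p} D_ℓ z^ℓ` (with `D_{-ℓ} = D_ℓᴴ`) is positive semidefinite for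
every `z` on the unit circle, then there exist matrices `Q₀, …, Q_p` such that
`P(z) = Q(z)ᴴ Q(z)` on the unit circle, where `Q(z) = ∑_{ℓ=0}^{p} Q_ℓ z^ℓ`. -/
theorem matrix_fejer_riesz
    (m p : ℕ) (hm : 0 < m) (hp : 0 < p)
    (D : ℤ → Matrix (Fin m) (Fin m) ℂ)
    (hherm : ∀ ℓ : ℤ, D (-ℓ) = (D ℓ)ᴴ)
    (hpos : ∀ z : ℂ, ‖z‖ = 1 →
      (∑ ℓ ∈ Finset.Icc (-(p : ℤ)) (p : ℤ), z ^ ℓ • D ℓ).PosSemidef) :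
    ∃ Q : ℕ → Matrix (Fin m) (Fin m) ℂ, ∀ z : ℂ, ‖z‖ = 1 →
      (∑ ℓ ∈ Finset.Icc (-(p : ℤ)) (p : ℤ), z ^ ℓ • D ℓ)
        = (∑ ℓ ∈ Finset.range (p + 1), z ^ ℓ • Q ℓ)ᴴ
          * (∑ ℓ ∈ Finset.range (p + 1), z ^ ℓ • Q ℓ) := by
  have hsum : ∀ z : ℂ, (∑ ℓ ∈ Finset.Icc (-(p : ℤ)) (p : ℤ),
      z ^ ℓ • (if |ℓ| ≤ (p : ℤ) then D ℓ else 0)) =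
      ∑ ℓ ∈ Finset.Icc (-(p : ℤ)) (p : ℤ), z ^ ℓ • D ℓ := fun z =>
    Finset.sum_congr rfl fun ℓ hℓ => by rw [if_pos (abs_le.mpr (Finset.mem_Icc.mp hℓ))]
  obtain ⟨Q, hQ⟩ := matrix_fejer_riesz_of_banded (p := p)
    (D := fun ℓ => if |ℓ| ≤ (p : ℤ) then D ℓ else 0)
    (fun ℓ hℓ => if_neg hℓ.not_ge)
    (fun ℓ => by
      simp only [abs_neg]
      split_ifs
      · exact hherm ℓ
      · simp)
    (fun z hz => by simpa only [hsum] using hpos z hz)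
  refine ⟨fun k => if h : k < p + 1 then Q ⟨k, h⟩ else 0, fun z hz => ?_⟩
  rw [← hsum, hQ z hz, Finset.sum_range]
  simp only [Fin.is_lt, dite_true, Fin.eta]
end

section
/- Let m, p, L be positive integers and D_ℓ ∈ ℂ^{m×m} for −p ≤ ℓ ≤ p with D_{−ℓ} = D_ℓ† for all ℓ, and suppose the matrix Laurent polynomial P(z) = Σ_{ℓ=−p}^{p} D_ℓ z^ℓ is positive semidefinite for every z with |z| = 1. Let D be the mL×mL block-Toeplitz matrix with (j,k) block D_{k−j} for |j−k| ≤ p and zero otherwise (j, k ∈ {1,…,L}). Then there exists an m(L+p) × mL matrix Q, whose (j,k) block equals Q_{j−k} for k ≤ j ≤ k+p and zero otherwise for some matrices Q₀,…,Q_p ∈ ℂ^{m×m}, such that Q†Q = D. -/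
open Matrix
open scoped ComplexOrder

section Autocorrelation

variable {ι H H' : Type*} [NormedAddCommGroup H] [InnerProductSpace ℂ H]
  [NormedAddCommGroup H'] [InnerProductSpace ℂ H']

/-- The lag-`l` autocorrelation, over the window `{0, …, N - 1}`, of a sequence of families of
vectors. -/
noncomputable def autocorr (N : ℕ) (g : ℕ → ι → H) (l : ℕ) (r s : ι) : ℂ :=
  ∑ k ∈ Finset.range N, inner ℂ (g (k + l) r) (g k s)

theorem continuous_autocorr (N l : ℕ) (r s : ι) :
    Continuous fun g : ℕ → ι → H => autocorr N g l r s := by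
  unfold autocorr
  fun_prop

theorem autocorr_map (f : H →ₗᵢ[ℂ] H') (N : ℕ) (g : ℕ → ι → H) :
    autocorr N (fun i r => f (g i r)) = autocorr N g := by
  funext l r s
  simp [autocorr]

theorem autocorr_eq_of_le {M N : ℕ} (hMN : M ≤ N) {g : ℕ → ι → H}
    (hg : ∀ i, M ≤ i → g i = 0) : autocorr N g = autocorr M g := by
  funext l r s
  refine (Finset.sum_subset (Finset.range_subset_range.2 hMN) fun k _ hk => ?_).symm
  simp [hg k (by simpa using hk)]

theorem autocorr_eq_zero_of_lt {p l : ℕ} {g : ℕ → ι → H} (hg : ∀ i, p + 1 ≤ i → g i = 0)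
    (hl : p < l) (N : ℕ) (r s : ι) : autocorr N g l r s = 0 :=
  Finset.sum_eq_zero fun k _ => by
    rw [hg (k + l) (by omega), Pi.zero_apply, inner_zero_left]

theorem autocorr_zero_self (N : ℕ) (g : ℕ → ι → H) (r : ι) :
    autocorr N g 0 r r = ((∑ k ∈ Finset.range N, ‖g k r‖ ^ 2 : ℝ) : ℂ) := by
  simp [autocorr, inner_self_eq_norm_sq_to_K]

theorem norm_le_sqrt_autocorr {N : ℕ} {g : ℕ → ι → H} (hg : ∀ i, N ≤ i → g i = 0)
    (i : ℕ) (r : ι) : ‖g i r‖ ≤ √ (autocorr N g 0 r r).re := by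
  by_cases hi : i < N
  · rw [autocorr_zero_self, Complex.ofReal_re]
    refine Real.le_sqrt_of_sq_le ?_
    exact Finset.single_le_sum (f := fun k => ‖g k r‖ ^ 2) (fun _ _ => by positivity)
      (Finset.mem_range.2 hi)
  · simp [hg i (not_lt.1 hi), Real.sqrt_nonneg]

/-- Sequences of families of vectors that vanish from `N` on and whose norms are bounded by `C`
form a compact set. -/
theorem isCompact_setOf_bounded_support [FiniteDimensional ℂ H] (N : ℕ) (C : ι → ℝ) :
    IsCompact {g : ℕ → ι → H | (∀ i, N ≤ i → g i = 0) ∧ ∀ i r, ‖g i r‖ ≤ C r} := by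
  have : ProperSpace H := FiniteDimensional.proper ℂ H
  refine (isCompact_univ_pi fun _ : ℕ => isCompact_univ_pi fun r : ι =>
    isCompact_closedBall (0 : H) (C r)).of_isClosed_subset ?_ ?_
  · have h1 : IsClosed {g : ℕ → ι → H | ∀ i, N ≤ i → g i = 0} := by
      simp only [Set.ofPred_forall]
      exact isClosed_iInter fun i => isClosed_iInter fun _ =>
        isClosed_eq (continuous_apply i) continuous_const
    have h2 : IsClosed {g : ℕ → ι → H | ∀ i r, ‖g i r‖ ≤ C r} := by
      simp only [Set.ofPred_forall]
      exact isClosed_iInter fun i => isClosed_iInter fun r =>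
        isClosed_le (by fun_prop) continuous_const
    exact h1.inter h2
  · rintro g ⟨-, hg⟩ i - r -
    simpa using hg i r

theorem Submodule.inner_starProjection_add_inner_sub (K : Submodule ℂ H)
    [K.HasOrthogonalProjection] (x y : H) :
    inner ℂ (K.starProjection x) (K.starProjection y)
      + inner ℂ (x - K.starProjection x) (y - K.starProjection y) = inner ℂ x y := by
  have h1 : inner ℂ (x - K.starProjection x) (K.starProjection y) = 0 :=
    K.starProjection_inner_eq_zero _ _ (K.starProjection_apply_mem y)
  have h2 : inner ℂ (y - K.starProjection y) (K.starProjection x) = 0 :=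
    K.starProjection_inner_eq_zero _ _ (K.starProjection_apply_mem x)
  have h3 : inner ℂ (K.starProjection x) (y - K.starProjection y) = 0 := by
    rw [← inner_conj_symm, h2, map_zero]
  conv_rhs => rw [← add_sub_cancel (K.starProjection x) x, ← add_sub_cancel (K.starProjection y) y]
  rw [inner_add_left, inner_add_right, inner_add_right, h1, h3]
  ring

/-- A finite-dimensional inner product space embeds isometrically into any one of larger
dimension. -/
theorem exists_linearIsometry_of_finrank_le [FiniteDimensional ℂ H] {m : ℕ}
    (h : Module.finrank ℂ H ≤ m) : Nonempty (H →ₗᵢ[ℂ] EuclideanSpace ℂ (Fin m)) := by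
  let b := stdOrthonormalBasis ℂ H
  let v : Fin (Module.finrank ℂ H) → EuclideanSpace ℂ (Fin m) :=
    fun i => EuclideanSpace.basisFun (Fin m) ℂ (Fin.castLE h i)
  have hv : Orthonormal ℂ v :=
    (EuclideanSpace.basisFun (Fin m) ℂ).orthonormal.comp _ (Fin.castLE_injective h)
  refine ⟨(b.toBasis.constr ℂ v).isometryOfOrthonormal (v := b.toBasis)
    (by simp) ?_⟩
  convert hv using 1
  funext i
  exact b.toBasis.constr_basis ℂ v i

section Fold

variable [FiniteDimensional ℂ H]

/-- Keep the component of a sequence in the span of its first term and shift the orthogonal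
component one step down. -/
noncomputable def foldSeq (g : ℕ → ι → H) (i : ℕ) (r : ι) : H :=
  (Submodule.span ℂ (Set.range (g 0))).starProjection (g i r)
    + (g (i + 1) r - (Submodule.span ℂ (Set.range (g 0))).starProjection (g (i + 1) r))

theorem inner_foldSeq (g : ℕ → ι → H) (i j : ℕ) (r s : ι) :
    inner ℂ (foldSeq g i r) (foldSeq g j s) =
      inner ℂ ((Submodule.span ℂ (Set.range (g 0))).starProjection (g i r))
          ((Submodule.span ℂ (Set.range (g 0))).starProjection (g j s))
        + inner ℂ
          (g (i + 1) r - (Submodule.span ℂ (Set.range (g 0))).starProjection (g (i + 1) r))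
          (g (j + 1) s - (Submodule.span ℂ (Set.range (g 0))).starProjection (g (j + 1) s)) := by
  set K := Submodule.span ℂ (Set.range (g 0))
  have h1 : ∀ x y : H, inner ℂ (x - K.starProjection x) (K.starProjection y) = 0 := fun x y =>
    K.starProjection_inner_eq_zero _ _ (K.starProjection_apply_mem y)
  have h2 : ∀ x y : H, inner ℂ (K.starProjection x) (y - K.starProjection y) = 0 := fun x y => by
    rw [← inner_conj_symm, h1, map_zero]
  simp only [foldSeq]
  rw [inner_add_left, inner_add_right, inner_add_right, h1, h2]
  ring

theorem sub_starProjection_span_zero (g : ℕ → ι → H) (r : ι) :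
    g 0 r - (Submodule.span ℂ (Set.range (g 0))).starProjection (g 0 r) = 0 := by
  rw [sub_eq_zero, eq_comm, Submodule.starProjection_eq_self_iff]
  exact Submodule.subset_span ⟨r, rfl⟩

theorem foldSeq_eq_zero {N : ℕ} {g : ℕ → ι → H} (hg : ∀ i, N ≤ i → g i = 0) (i : ℕ)
    (hi : N ≤ i) : foldSeq g i = 0 := by
  funext r
  simp [foldSeq, hg i hi, hg (i + 1) (hi.trans (Nat.le_succ i))]

theorem autocorr_foldSeq {N : ℕ} {g : ℕ → ι → H} (hg : ∀ i, N ≤ i → g i = 0) :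
    autocorr N (foldSeq g) = autocorr N g := by
  funext l r s
  unfold autocorr
  simp_rw [inner_foldSeq]
  set K := Submodule.span ℂ (Set.range (g 0)) with hK
  rw [Finset.sum_add_distrib]
  set h : ℕ → ℂ := fun k =>
    inner ℂ (g (k + l) r - K.starProjection (g (k + l) r)) (g k s - K.starProjection (g k s))
    with hh
  have h0 : h 0 = 0 := by simp only [hh, hK, sub_starProjection_span_zero, inner_zero_right]
  have hN : h N = 0 := by simp [hh, hg N le_rfl]
  have hshift : ∑ k ∈ Finset.range N, h (k + 1) = ∑ k ∈ Finset.range N, h k := by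
    have := Finset.sum_range_succ' h N
    rw [Finset.sum_range_succ, h0, hN, add_zero, add_zero] at this
    exact this.symm
  have : ∀ k, inner ℂ (g (k + l + 1) r - K.starProjection (g (k + l + 1) r))
      (g (k + 1) s - K.starProjection (g (k + 1) s)) = h (k + 1) := fun k => by
    simp only [hh, add_right_comm]
  simp_rw [this]
  rw [hshift, ← Finset.sum_add_distrib]
  exact Finset.sum_congr rfl fun k _ => K.inner_starProjection_add_inner_sub _ _

theorem starProjection_span_zero_eq_zero {p : ℕ} {g : ℕ → ι → H}
    (hband : ∀ i j r s, i + p < j → inner ℂ (g j r) (g i s) = 0) {j : ℕ} (hj : p < j) (r : ι) :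
    (Submodule.span ℂ (Set.range (g 0))).starProjection (g j r) = 0 := by
  rw [Submodule.starProjection_apply_eq_zero_iff, Submodule.mem_orthogonal']
  intro u hu
  induction hu using Submodule.span_induction with
  | mem x hx => obtain ⟨s, rfl⟩ := hx; exact hband 0 j r s (by omega)
  | zero => simp
  | add x y _ _ hx hy => rw [inner_add_right, hx, hy, add_zero]
  | smul a x _ hx => rw [inner_smul_right, hx, mul_zero]

theorem inner_foldSeq_eq_zero {p : ℕ} {g : ℕ → ι → H}
    (hband : ∀ i j r s, i + p < j → inner ℂ (g j r) (g i s) = 0) (i j : ℕ) (r s : ι)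
    (hij : i + p < j) : inner ℂ (foldSeq g j r) (foldSeq g i s) = 0 := by
  rw [inner_foldSeq, starProjection_span_zero_eq_zero hband (by omega : p < j), inner_zero_left,
    zero_add, starProjection_span_zero_eq_zero hband (by omega : p < j + 1), sub_zero,
    inner_sub_right, hband _ _ _ _ (by omega), zero_sub, neg_eq_zero]
  have h := starProjection_span_zero_eq_zero hband (by omega : p < j + 1) r
  rw [Submodule.starProjection_apply_eq_zero_iff, Submodule.mem_orthogonal'] at h
  exact h _ (Submodule.starProjection_apply_mem _ _)

variable [Fintype ι]

/-- The first moment of the squared norms of a sequence of families of vectors. -/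
noncomputable def moment (N : ℕ) (g : ℕ → ι → H) : ℝ :=
  ∑ k ∈ Finset.range N, (k : ℝ) * ∑ r, ‖g k r‖ ^ 2

theorem moment_foldSeq_add {N : ℕ} {g : ℕ → ι → H} (hg : ∀ i, N ≤ i → g i = 0) :
    moment N (foldSeq g) + ∑ k ∈ Finset.range N, ∑ r,
      ‖g k r - (Submodule.span ℂ (Set.range (g 0))).starProjection (g k r)‖ ^ 2
      = moment N g := by
  have hnorm : ∀ i r, ‖foldSeq g i r‖ ^ 2 =
      ‖(Submodule.span ℂ (Set.range (g 0))).starProjection (g i r)‖ ^ 2 +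
      ‖g (i + 1) r
        - (Submodule.span ℂ (Set.range (g 0))).starProjection (g (i + 1) r)‖ ^ 2 := by
    intro i r
    have := inner_foldSeq g i i r r
    simp only [inner_self_eq_norm_sq_to_K] at this
    exact_mod_cast this
  unfold moment
  simp_rw [hnorm]
  set K := Submodule.span ℂ (Set.range (g 0)) with hK
  have hsplit : ∀ i r, ‖g i r‖ ^ 2 =
      ‖K.starProjection (g i r)‖ ^ 2 + ‖g i r - K.starProjection (g i r)‖ ^ 2 := by
    intro i r
    have := K.inner_starProjection_add_inner_sub (g i r) (g i r)
    simp only [inner_self_eq_norm_sq_to_K] at this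
    exact_mod_cast this.symm
  simp_rw [hsplit, Finset.sum_add_distrib, mul_add, Finset.sum_add_distrib]
  set a : ℕ → ℝ := fun k => ∑ r, ‖g k r - K.starProjection (g k r)‖ ^ 2 with ha
  have h0 : a 0 = 0 := by simp [ha, hK, sub_starProjection_span_zero]
  have hN : a N = 0 := by simp [ha, hg N le_rfl]
  have h1 := Finset.sum_range_succ' a N
  rw [Finset.sum_range_succ, h0, hN, add_zero, add_zero] at h1
  have h2 := Finset.sum_range_succ' (fun k : ℕ => (k : ℝ) * a k) N
  rw [Finset.sum_range_succ, hN] at h2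
  simp only [Nat.cast_add, Nat.cast_one, add_mul, one_mul, Nat.cast_zero, zero_mul, mul_zero,
    add_zero, Finset.sum_add_distrib] at h2
  linarith

/-- A finitely supported sequence of families of `m` vectors whose Gram kernel is banded has the
same autocorrelation as a sequence in `ℂᵐ` supported in the band. -/
theorem exists_band_supported_autocorr_eq {m N p : ℕ} {b : ℕ → Fin m → H}
    (hb : ∀ i, N ≤ i → b i = 0)
    (hband : ∀ i j r s, i + p < j → inner ℂ (b j r) (b i s) = 0) :
    ∃ q : ℕ → Fin m → EuclideanSpace ℂ (Fin m),
      (∀ i, N ≤ i → q i = 0) ∧ (∀ i, p < i → q i = 0) ∧ autocorr N q = autocorr N b := by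
  set A : Set (ℕ → Fin m → H) := {g | (∀ i, N ≤ i → g i = 0) ∧
    (∀ i j r s, i + p < j → inner ℂ (g j r) (g i s) = 0) ∧ autocorr N g = autocorr N b}
  have hcompact : IsCompact A := by
    have h1 : IsClosed {g : ℕ → Fin m → H |
        ∀ i j r s, i + p < j → inner ℂ (g j r) (g i s) = 0} := by
      simp only [Set.ofPred_forall]
      exact isClosed_iInter fun i => isClosed_iInter fun j => isClosed_iInter fun r =>
        isClosed_iInter fun s => isClosed_iInter fun _ =>
          isClosed_eq (by fun_prop) continuous_const
    have h2 : IsClosed {g : ℕ → Fin m → H | autocorr N g = autocorr N b} :=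
      isClosed_eq (continuous_pi fun l => continuous_pi fun r => continuous_pi fun s =>
        continuous_autocorr N l r s) continuous_const
    convert (isCompact_setOf_bounded_support (H := H) N
      fun r : Fin m => √ (autocorr N b 0 r r).re).inter_right (h1.inter h2) using 1
    ext g
    refine ⟨fun h => ⟨⟨h.1, fun i r => ?_⟩, h.2⟩, fun h => ⟨h.1.1, h.2⟩⟩
    rw [← h.2.2]
    exact norm_le_sqrt_autocorr h.1 i r
  have hcont : Continuous fun g : ℕ → Fin m → H => moment N g := by
    unfold moment
    fun_prop
  obtain ⟨g, ⟨hg0, hgband, hgauto⟩, hmin⟩ :=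
    hcompact.exists_isMinOn ⟨b, hb, hband, rfl⟩ hcont.continuousOn
  have hfold : foldSeq g ∈ A := ⟨foldSeq_eq_zero hg0,
    fun i j r s => inner_foldSeq_eq_zero hgband i j r s, (autocorr_foldSeq hg0).trans hgauto⟩
  have hle : moment N g ≤ moment N (foldSeq g) := hmin hfold
  have hsum := moment_foldSeq_add hg0
  set K := Submodule.span ℂ (Set.range (g 0)) with hK
  have hzero : ∑ k ∈ Finset.range N, ∑ r, ‖g k r - K.starProjection (g k r)‖ ^ 2 = 0 :=
    le_antisymm (by linarith) (by positivity)
  have hproj : ∀ i r, K.starProjection (g i r) = g i r := by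
    intro i r
    by_cases hi : i < N
    · have h1 := (Finset.sum_eq_zero_iff_of_nonneg fun _ _ => by positivity).1 hzero i
        (Finset.mem_range.2 hi)
      have h2 := (Finset.sum_eq_zero_iff_of_nonneg fun _ _ => by positivity).1 h1 r
        (Finset.mem_univ r)
      rw [sq_eq_zero_iff, norm_eq_zero, sub_eq_zero] at h2
      exact h2.symm
    · simp [hg0 i (not_lt.1 hi)]
  have hmem : ∀ i r, g i r ∈ K := fun i r => Submodule.starProjection_eq_self_iff.1 (hproj i r)
  obtain ⟨f⟩ := exists_linearIsometry_of_finrank_le (H := K) (m := m)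
    ((finrank_range_le_card (R := ℂ) (g 0)).trans_eq (Fintype.card_fin m))
  refine ⟨fun i r => f ⟨g i r, hmem i r⟩, fun i hi => ?_, fun i hi => ?_, ?_⟩
  · funext r
    have : (⟨g i r, hmem i r⟩ : K) = 0 := Subtype.ext (by simp [hg0 i hi])
    exact (congrArg f this).trans (map_zero f)
  · funext r
    have : (⟨g i r, hmem i r⟩ : K) = 0 := Subtype.ext
      ((hproj i r).symm.trans (starProjection_span_zero_eq_zero hgband hi r))
    exact (congrArg f this).trans (map_zero f)
  · rw [autocorr_map f N fun i r => (⟨g i r, hmem i r⟩ : K), ← hgauto,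
      ← autocorr_map K.subtypeₗᵢ]
    rfl

end Fold

end Autocorrelation

/-- Orthogonality of the characters of `ℤ / M` at small frequencies. -/
theorem IsPrimitiveRoot.sum_zpow_eq_ite {M : ℕ} {ζ : ℂ} (hζ : IsPrimitiveRoot ζ M) {n : ℤ}
    (hn : |n| < M) : ∑ a ∈ Finset.range M, (ζ ^ a) ^ n = if n = 0 then (M : ℂ) else 0 := by
  split_ifs with h
  · simp [h]
  · have h1 : ζ ^ n ≠ 1 := fun h1 =>
      h (Int.eq_zero_of_abs_lt_dvd ((hζ.zpow_eq_one_iff_dvd n).1 h1) hn)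
    have h2 : ∀ a : ℕ, (ζ ^ a) ^ n = (ζ ^ n) ^ a := fun a => by
      rw [← zpow_natCast, ← zpow_natCast, zpow_comm]
    simp_rw [h2]
    have h3 := geom_sum_mul (ζ ^ n) M
    rw [← h2, hζ.pow_eq_one, _root_.one_zpow, sub_self] at h3
    exact (mul_eq_zero.1 h3).resolve_right (sub_ne_zero.2 h1)

open scoped MatrixOrder Matrix.Norms.L2Operator in
theorem Matrix.PosSemidef.exists_eq_conjTranspose_mul_self_s16 {n : Type*} [Fintype n]
    {A : Matrix n n ℂ} (hA : A.PosSemidef) : ∃ B : Matrix n n ℂ, A = Bᴴ * B := by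
  classical
  exact CStarAlgebra.nonneg_iff_eq_star_mul_self.1 hA.nonneg

section Toeplitz

variable {m p : ℕ} {D : ℤ → Matrix (Fin m) (Fin m) ℂ}

/-- Finite block-Toeplitz sections of the coefficients of a matrix Laurent polynomial that is
positive semidefinite on the unit circle are positive semidefinite. -/
theorem posSemidef_toeplitz (hpos : ∀ z : ℂ, ‖z‖ = 1 →
      (∑ ℓ ∈ Finset.Icc (-(p : ℤ)) (p : ℤ), z ^ ℓ • D ℓ).PosSemidef) (N : ℕ) :
    (Matrix.of fun x y : Fin N × Fin m =>
      if |(x.1 : ℤ) - y.1| ≤ p then D ((x.1 : ℤ) - y.1) x.2 y.2 else 0).PosSemidef := by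
  set M : ℕ := N + p + 1 with hM
  have hM0 : M ≠ 0 := by omega
  set ζ : ℂ := Complex.exp (2 * Real.pi * Complex.I / M)
  have hζ : IsPrimitiveRoot ζ M := Complex.isPrimitiveRoot_exp M hM0
  have hζn : ‖ζ‖ = 1 := hζ.norm'_eq_one hM0
  have hζ0 : ζ ≠ 0 := norm_ne_zero_iff.1 (by simp [hζn])
  let U : ℂ → Matrix (Fin m) (Fin N × Fin m) ℂ :=
    fun z => Matrix.of fun r y => if r = y.2 then z ^ (y.1 : ℤ) else 0
  have hsum : ((M : ℂ)⁻¹ • ∑ a ∈ Finset.range M, (U (ζ ^ a))ᴴ *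
      (∑ ℓ ∈ Finset.Icc (-(p : ℤ)) (p : ℤ), (ζ ^ a) ^ ℓ • D ℓ) * U (ζ ^ a)).PosSemidef := by
    refine PosSemidef.smul (Matrix.posSemidef_sum _ fun a _ => ?_) ?_
    · exact (hpos _ (by simp [hζn])).conjTranspose_mul_mul_same _
    · exact inv_nonneg.2 (by positivity)
  convert hsum using 1
  ext ⟨j, r⟩ ⟨k, s⟩
  have hconj : ∀ (a i : ℕ), star ((ζ ^ a) ^ i) = (ζ ^ a) ^ (-(i : ℤ)) := fun a i => by
    rw [_root_.zpow_neg, zpow_natCast, Complex.inv_def, Complex.normSq_eq_norm_sq]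
    simp [hζn]
  have hentry : ∀ a, ((U (ζ ^ a))ᴴ * (∑ ℓ ∈ Finset.Icc (-(p : ℤ)) (p : ℤ), (ζ ^ a) ^ ℓ • D ℓ)
      * U (ζ ^ a)) (j, r) (k, s) =
      ∑ ℓ ∈ Finset.Icc (-(p : ℤ)) (p : ℤ), (ζ ^ a) ^ (ℓ + k - j) * D ℓ r s := by
    intro a
    have hza : ζ ^ a ≠ 0 := pow_ne_zero _ hζ0
    simp only [Matrix.mul_apply, U, Matrix.conjTranspose_apply, Matrix.of_apply, Matrix.sum_apply,
      Matrix.smul_apply, smul_eq_mul, mul_ite, mul_zero, Finset.sum_ite_eq', Finset.mem_univ,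
      if_true, apply_ite star, star_zero, ite_mul, zero_mul, zpow_natCast, hconj]
    rw [Finset.mul_sum, Finset.sum_mul]
    refine Finset.sum_congr rfl fun ℓ _ => ?_
    rw [sub_eq_add_neg, zpow_add₀ hza, zpow_add₀ hza, zpow_natCast]
    ring
  rw [Matrix.smul_apply, Matrix.sum_apply]
  simp_rw [hentry]
  rw [Finset.sum_comm]
  have hinner : ∀ ℓ ∈ Finset.Icc (-(p : ℤ)) (p : ℤ),
      ∑ a ∈ Finset.range M, (ζ ^ a) ^ (ℓ + k - j) * D ℓ r s =
      if ℓ = (j : ℤ) - k then (M : ℂ) * D ((j : ℤ) - k) r s else 0 := by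
    intro ℓ hℓ
    rw [Finset.mem_Icc] at hℓ
    have hj := j.2
    have hk := k.2
    rw [← Finset.sum_mul, hζ.sum_zpow_eq_ite (by rw [abs_lt]; omega)]
    by_cases h : ℓ = (j : ℤ) - k
    · rw [if_pos h, if_pos (by omega), h]
    · rw [if_neg h, if_neg (by omega), zero_mul]
  rw [Finset.sum_congr rfl hinner, Finset.sum_ite_eq']
  simp only [Matrix.of_apply, Finset.mem_Icc, abs_le]
  have : (M : ℂ) ≠ 0 := by exact_mod_cast hM0
  split_ifs <;> simp [this]

/-- The Cesàro-weighted coefficients are autocorrelations of sequences in `ℂᵐ` supported in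
`{0, …, p}`. -/
theorem exists_autocorr_eq_cesaro (hpos : ∀ z : ℂ, ‖z‖ = 1 →
      (∑ ℓ ∈ Finset.Icc (-(p : ℤ)) (p : ℤ), z ^ ℓ • D ℓ).PosSemidef) (N : ℕ) (hN : p < N) :
    ∃ q : ℕ → Fin m → EuclideanSpace ℂ (Fin m), (∀ i, p + 1 ≤ i → q i = 0) ∧
      ∀ l ≤ p, ∀ r s, autocorr (p + 1) q l r s = (1 - (l : ℂ) / N) * D l r s := by
  have hT := (posSemidef_toeplitz hpos N).smul (a := (N : ℂ)⁻¹) (inv_nonneg.2 (by positivity))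
  obtain ⟨B, hB⟩ := hT.exists_eq_conjTranspose_mul_self_s16
  let b : ℕ → Fin m → EuclideanSpace ℂ (Fin N × Fin m) := fun i r =>
    if h : i < N then WithLp.toLp 2 fun x => B x (⟨i, h⟩, r) else 0
  have hb : ∀ i, N ≤ i → b i = 0 := fun i hi => by
    funext r
    simp [b, not_lt.2 hi]
  have hinner : ∀ i j r s, i < N → j < N → inner ℂ (b i r) (b j s) =
      (N : ℂ)⁻¹ * if |(i : ℤ) - j| ≤ p then D ((i : ℤ) - j) r s else 0 := by
    intro i j r s hi hj
    have := congrFun (congrFun hB (⟨i, hi⟩, r)) (⟨j, hj⟩, s)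
    simp only [Matrix.smul_apply, Matrix.of_apply, smul_eq_mul, Matrix.mul_apply,
      Matrix.conjTranspose_apply] at this
    rw [this]
    simp [b, hi, hj, PiLp.inner_apply, mul_comm]
  have hband : ∀ i j r s, i + p < j → inner ℂ (b j r) (b i s) = 0 := by
    intro i j r s hij
    by_cases hj : j < N
    · rw [hinner j i r s hj (by omega), if_neg (by rw [abs_le]; omega), mul_zero]
    · rw [hb j (by omega), Pi.zero_apply, inner_zero_left]
  obtain ⟨q, hqN, hqp, hq⟩ := exists_band_supported_autocorr_eq hb hband
  refine ⟨q, hqp, fun l hl r s => ?_⟩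
  rw [← autocorr_eq_of_le (N := N) (by omega) hqp, hq]
  have hN0 : (N : ℂ) ≠ 0 := by exact_mod_cast (by omega : N ≠ 0)
  have hterm : ∀ k ∈ Finset.range N, inner ℂ (b (k + l) r) (b k s) =
      if k < N - l then (N : ℂ)⁻¹ * D l r s else 0 := by
    intro k hk
    rw [Finset.mem_range] at hk
    split_ifs with h
    · rw [hinner _ _ _ _ (by omega) hk]
      push_cast
      rw [add_sub_cancel_left, if_pos (by rw [abs_le]; omega)]
    · rw [hb (k + l) (by omega), Pi.zero_apply, inner_zero_left]
  unfold autocorr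
  rw [Finset.sum_congr rfl hterm, ← Finset.sum_filter, Finset.sum_const]
  have hcard : ((Finset.range N).filter (· < N - l)).card = N - l := by
    have : (Finset.range N).filter (· < N - l) = Finset.range (N - l) := by
      ext k
      simp only [Finset.mem_filter, Finset.mem_range]
      omega
    rw [this, Finset.card_range]
  rw [hcard, nsmul_eq_mul, Nat.cast_sub (by omega)]
  field_simp

/-- The matrix-valued Fejér–Riesz theorem, as a statement about autocorrelations. -/
theorem exists_autocorr_eq (hpos : ∀ z : ℂ, ‖z‖ = 1 →
      (∑ ℓ ∈ Finset.Icc (-(p : ℤ)) (p : ℤ), z ^ ℓ • D ℓ).PosSemidef) :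
    ∃ q : ℕ → Fin m → EuclideanSpace ℂ (Fin m), (∀ i, p + 1 ≤ i → q i = 0) ∧
      ∀ l ≤ p, ∀ r s, autocorr (p + 1) q l r s = D l r s := by
  choose q hq0 hq using fun n : ℕ => exists_autocorr_eq_cesaro hpos (p + 1 + n) (by omega)
  set S : Set (ℕ → Fin m → EuclideanSpace ℂ (Fin m)) :=
    {g | (∀ i, p + 1 ≤ i → g i = 0) ∧ ∀ i r, ‖g i r‖ ≤ √ (D 0 r r).re}
  have hScompact : IsCompact S := isCompact_setOf_bounded_support _ _
  let Φ : (ℕ → Fin m → EuclideanSpace ℂ (Fin m)) → Fin (p + 1) → Fin m → Fin m → ℂ :=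
    fun g l => autocorr (p + 1) g l
  have hΦ : Continuous Φ := continuous_pi fun l => continuous_pi fun r => continuous_pi fun s =>
    continuous_autocorr _ _ _ _
  have hqS : ∀ n, q n ∈ S := fun n => ⟨hq0 n, fun i r => by
    have := norm_le_sqrt_autocorr (hq0 n) i r
    rw [hq n 0 (Nat.zero_le _)] at this
    simpa using this⟩
  have hlim : Filter.Tendsto (fun n => Φ (q n)) Filter.atTop
      (nhds fun (l : Fin (p + 1)) r s => D (l : ℕ) r s) := by
    simp only [tendsto_pi_nhds]
    intro l r s
    have : ∀ n, Φ (q n) l r s = (1 - (l : ℕ) / ((p + 1 + n : ℕ) : ℂ)) * D (l : ℕ) r s :=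
      fun n => hq n l (by omega) r s
    simp_rw [this]
    have h1 : Filter.Tendsto (fun n : ℕ => ((l : ℕ) : ℂ) / ((p + 1 + n : ℕ) : ℂ)) Filter.atTop
        (nhds 0) := by
      have h2 := tendsto_const_div_atTop_nhds_zero_nat (𝕜 := ℂ) ((l : ℕ) : ℂ)
      have h3 := (Filter.tendsto_add_atTop_iff_nat (p + 1)).2 h2
      simpa only [add_comm] using h3
    simpa using (h1.const_sub 1).mul_const (D (l : ℕ) r s)
  obtain ⟨g, hg, hgD⟩ := (hScompact.image hΦ).isClosed.mem_of_tendsto hlim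
    (Filter.Eventually.of_forall fun n => ⟨_, hqS n, rfl⟩)
  exact ⟨g, hg.1, fun l hl r s =>
    congrFun (congrFun (congrFun hgD ⟨l, Nat.lt_succ_of_le hl⟩) r) s⟩

end Toeplitz

/-- paper's Theorem 1 in full: if the matrix Laurent polynomial
`P(z) = ∑_{ℓ=-p}^p D_ℓ z^ℓ` (with `D_{-ℓ} = D_ℓᴴ`) is positive semidefinite on the unit
circle, then the `mL × mL` block-Toeplitz matrix `D` (with `(j,k)` block `D_{k-j}` for
`|j-k| ≤ p`, zero otherwise) admits a banded block lower-triangular factor: there is an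
`m(L+p) × mL` matrix `Q` whose `(j,k)` block is `Q_{j-k}` for `k ≤ j ≤ k+p` (zero otherwise)
for some `Q₀,…,Q_p ∈ ℂ^{m×m}`, with `QᴴQ = D`. -/
theorem lattice_fejer_riesz_block_factorization
    (m p L : ℕ) (hm : 0 < m) (hp : 0 < p) (hL : 0 < L)
    (D : ℤ → Matrix (Fin m) (Fin m) ℂ)
    (hherm : ∀ ℓ : ℤ, D (-ℓ) = (D ℓ)ᴴ)
    (hpos : ∀ z : ℂ, ‖z‖ = 1 →
      (∑ ℓ ∈ Finset.Icc (-(p : ℤ)) (p : ℤ), z ^ ℓ • D ℓ).PosSemidef)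
    (Dbig : Matrix (Fin L × Fin m) (Fin L × Fin m) ℂ)
    (hDbig : ∀ jr kc : Fin L × Fin m,
      Dbig jr kc = if |(kc.1 : ℤ) - (jr.1 : ℤ)| ≤ (p : ℤ)
        then D ((kc.1 : ℤ) - (jr.1 : ℤ)) jr.2 kc.2 else 0) :
    ∃ Q : ℤ → Matrix (Fin m) (Fin m) ℂ,
      (∀ i : ℤ, (i < 0 ∨ (p : ℤ) < i) → Q i = 0) ∧
      ∃ Qbig : Matrix (Fin (L + p) × Fin m) (Fin L × Fin m) ℂ,
        (∀ (jr : Fin (L + p) × Fin m) (kc : Fin L × Fin m),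
          Qbig jr kc = Q ((jr.1 : ℤ) - (kc.1 : ℤ)) jr.2 kc.2) ∧
        Qbigᴴ * Qbig = Dbig := by
  obtain ⟨q, hq0, hq⟩ := exists_autocorr_eq hpos
  let Q : ℤ → Matrix (Fin m) (Fin m) ℂ :=
    fun i => if i < 0 then 0 else Matrix.of fun a s => q i.toNat s a
  have hQneg : ∀ i < 0, Q i = 0 := fun i hi => if_pos hi
  have hQnat : ∀ (n : ℕ) a s, Q n a s = q n s a := fun n a s => by
    simp [Q, not_lt.2 (Int.natCast_nonneg n)]
  refine ⟨Q, ?_, Matrix.of fun jr kc => Q ((jr.1 : ℤ) - kc.1) jr.2 kc.2, fun _ _ => rfl, ?_⟩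
  · rintro i (hi | hi)
    · exact hQneg i hi
    · lift i to ℕ using by omega
      ext a s
      rw [hQnat, hq0 i (by omega)]
      rfl
  set B : Matrix (Fin (L + p) × Fin m) (Fin L × Fin m) ℂ :=
    Matrix.of fun jr kc => Q ((jr.1 : ℤ) - kc.1) jr.2 kc.2 with hB
  have hupper : ∀ x y : Fin L × Fin m, x.1 ≤ y.1 → (Bᴴ * B) x y = Dbig x y := by
    rintro ⟨j, r⟩ ⟨k, s⟩ hjk
    obtain ⟨l, hl⟩ := Nat.exists_eq_add_of_le (show (j : ℕ) ≤ k from hjk)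
    have hk := k.2
    have hsum : (Bᴴ * B) (j, r) (k, s) = autocorr (p + 1) q l r s := by
      rw [← autocorr_eq_of_le (N := L + p - k) (by omega) hq0]
      simp only [Matrix.mul_apply, Fintype.sum_prod_type, Matrix.conjTranspose_apply, hB,
        Matrix.of_apply]
      rw [Fin.sum_univ_eq_sum_range
        (fun i => ∑ a, star (Q ((i : ℤ) - j) a r) * Q ((i : ℤ) - k) a s) (L + p)]
      conv_lhs => rw [show L + p = k + (L + p - k) by omega]
      rw [Finset.sum_range_add, Finset.sum_eq_zero, zero_add]
      · refine Finset.sum_congr rfl fun t _ => ?_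
        have h1 : ((k + t : ℕ) : ℤ) - j = (t + l : ℕ) := by omega
        have h2 : ((k + t : ℕ) : ℤ) - k = t := by omega
        simp only [h1, h2, hQnat]
        simp [PiLp.inner_apply, mul_comm]
      · intro i hi
        rw [Finset.mem_range] at hi
        simp [hQneg ((i : ℤ) - k) (by omega)]
    have hdiff : (k : ℤ) - j = l := by omega
    rw [hsum, hDbig]
    simp only [hdiff]
    split_ifs with h
    · exact hq l (by simpa using h) r s
    · exact autocorr_eq_zero_of_lt hq0 (by simpa using h) _ _ _
  ext x y
  rcases le_total x.1 y.1 with h | h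
  · exact hupper x y h
  · have hstar : Dbig x y = star (Dbig y x) := by
      rw [hDbig, hDbig, abs_sub_comm, ← neg_sub (x.1 : ℤ) y.1, hherm]
      split_ifs <;> simp
    rw [hstar, ← hupper y x h, ← Matrix.conjTranspose_apply, Matrix.conjTranspose_mul,
      Matrix.conjTranspose_conjTranspose]
end
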